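/- arXiv:1801.00784 — 3 statements merged into one kernel-verified Lean document; each statement's English description precedes it below -/
import Mathlib

section
/- Let t < T, let {φ_j}_{j=0}^∞ be the trigonometric system on [t,T], and let ψ_1, ψ_2 : [t,T] → ℝ be continuously differentiable. Then for every (t_1,t_2) ∈ (t,T)², for each fixed p_1 the limit over p_2 of the double partial sums exists and the iterated limit satisfies lim_{p_1→∞} lim_{p_2→∞} Σ_{j_1=0}^{p_1} Σ_{j_2=0}^{p_2} C_{j_1 j_2}·φ_{j_1}(t_1)·φ_{j_2}(t_2) = K*(t_1,t_2) = ψ_1(t_1)·ψ_2(t_2)·(1_{{t_1<t_2}} + ½·1_{{t_1=t_2}}). -/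
open MeasureTheory Filter

/-- The trigonometric system on `[t, T]`. -/
noncomputable def trigPhi (t T : ℝ) (j : ℕ) (s : ℝ) : ℝ :=
  if j = 0 then 1 / Real.sqrt (T - t)
  else if j % 2 = 1 then
    Real.sqrt (2 / (T - t)) * Real.sin (2 * Real.pi * (((j + 1) / 2 : ℕ) : ℝ) * (s - t) / (T - t))
  else
    Real.sqrt (2 / (T - t)) * Real.cos (2 * Real.pi * ((j / 2 : ℕ) : ℝ) * (s - t) / (T - t))

/-- `K*(t₁,t₂) = ψ₁(t₁)·ψ₂(t₂)·(1_{t₁<t₂} + ½·1_{t₁=t₂})`. -/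
noncomputable def Kstar2 (ψ₁ ψ₂ : ℝ → ℝ) (t₁ t₂ : ℝ) : ℝ :=
  ψ₁ t₁ * ψ₂ t₂ * ((if t₁ < t₂ then (1 : ℝ) else 0) + (if t₁ = t₂ then (1 : ℝ) / 2 else 0))

/-- The Fourier coefficient
`C_{j₁ j₂} = ∫_t^T ψ₂(t₂) φ_{j₂}(t₂) (∫_t^{t₂} ψ₁(t₁) φ_{j₁}(t₁) dt₁) dt₂`. -/
noncomputable def trigCoef2 (t T : ℝ) (ψ₁ ψ₂ : ℝ → ℝ) (j₁ j₂ : ℕ) : ℝ :=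
  ∫ t₂ in t..T, ψ₂ t₂ * trigPhi t T j₂ t₂ * ∫ t₁ in t..t₂, ψ₁ t₁ * trigPhi t T j₁ t₁

open Topology intervalIntegral

/-- The Riemann–Lebesgue lemma on a bounded interval, for sine waves with arbitrary phase. -/
theorem tendsto_intervalIntegral_mul_sin {f : ℝ → ℝ} {a b : ℝ}
    (hf : ContinuousOn f (Set.uIcc a b)) (c : ℝ) :
    Tendsto (fun w : ℝ => ∫ s in a..b, f s * Real.sin (w * (s - c))) atTop (𝓝 0) := by
  wlog hab : a ≤ b generalizing a b
  · have := this (a := b) (b := a) (by rwa [Set.uIcc_comm]) (le_of_not_ge hab)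
    simpa [integral_symm b a] using this.neg
  have key := (Real.tendsto_integral_exp_smul_cocompact
    ((Set.Ioc a b).indicator fun s => (f s : ℂ))).comp
    ((tendsto_neg_atTop_atBot.mono_right atBot_le_cocompact).comp
      (tendsto_id.atTop_div_const Real.two_pi_pos))
  refine squeeze_zero_norm (fun w => ?_) (tendsto_zero_iff_norm_tendsto_zero.1 key)
  have hint : IntervalIntegrable (fun s : ℝ => (f s : ℂ) * Complex.exp ((w * (s - c) : ℝ) * Complex.I))
      volume a b := by
    apply ContinuousOn.intervalIntegrable
    refine (Complex.continuous_ofReal.comp_continuousOn hf).mul (Continuous.continuousOn ?_)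
    fun_prop
  have him : ∫ s in a..b, f s * Real.sin (w * (s - c)) =
      (∫ s in a..b, (f s : ℂ) * Complex.exp ((w * (s - c) : ℝ) * Complex.I)).im := by
    have := Complex.imCLM.intervalIntegral_comp_comm hint
    simp only [Complex.imCLM_apply] at this
    rw [← this]
    refine integral_congr fun s _ => ?_
    simp only [Complex.im_ofReal_mul, Complex.exp_ofReal_mul_I_im]
  have hshift : ∫ s in a..b, (f s : ℂ) * Complex.exp ((w * (s - c) : ℝ) * Complex.I) =
      Complex.exp ((-(w * c) : ℝ) * Complex.I) *
        ∫ v, Real.fourierChar (-(v * (-(w / (2 * Real.pi))))) •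
          (Set.Ioc a b).indicator (fun s => (f s : ℂ)) v := by
    rw [integral_of_le hab, ← MeasureTheory.integral_indicator measurableSet_Ioc,
      ← MeasureTheory.integral_const_mul]
    refine integral_congr_ae (.of_forall fun s => ?_)
    by_cases hs : s ∈ Set.Ioc a b
    · simp only [Set.indicator_of_mem hs, Circle.smul_def, Real.fourierChar_apply, smul_eq_mul]
      rw [← mul_assoc, ← Complex.exp_add, mul_comm]
      congr 2
      push_cast
      field_simp
      ring
    · simp [Set.indicator_of_notMem hs]
  rw [him, Real.norm_eq_abs]
  refine (Complex.abs_im_le_norm _).trans ?_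
  rw [hshift, norm_mul, Complex.norm_exp_ofReal_mul_I, one_mul]
  rfl

/-- The Dirichlet kernel of period `L`, normalised to have integral one over a period. -/
noncomputable def dirichletKer (L : ℝ) (N : ℕ) (u : ℝ) : ℝ :=
  1 / L * (1 + 2 * ∑ k ∈ Finset.range N, Real.cos (2 * Real.pi * ((k + 1 : ℕ) : ℝ) * u / L))

theorem continuous_dirichletKer (L : ℝ) (N : ℕ) : Continuous (dirichletKer L N) := by
  unfold dirichletKer
  fun_prop

theorem dirichletKer_mul_sin {L : ℝ} (hL : 0 < L) (N : ℕ) (u : ℝ) :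
    L * dirichletKer L N u * Real.sin (Real.pi / L * u) =
      Real.sin ((2 * N + 1) * (Real.pi / L) * u) := by
  induction N with
  | zero => simp [dirichletKer, hL.ne']
  | succ N ih =>
    have hstep : L * dirichletKer L (N + 1) u = L * dirichletKer L N u +
        2 * Real.cos ((2 * N + 2) * (Real.pi / L) * u) := by
      simp only [dirichletKer, Finset.sum_range_succ]
      have : 2 * Real.pi * ((N + 1 : ℕ) : ℝ) * u / L = (2 * N + 2) * (Real.pi / L) * u := by
        push_cast; ring
      rw [this]
      linear_combination 2 * Real.cos ((2 * N + 2) * (Real.pi / L) * u) * mul_one_div_cancel hL.ne'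
    have h₁ : (2 * ((N + 1 : ℕ) : ℝ) + 1) * (Real.pi / L) * u =
        (2 * N + 2) * (Real.pi / L) * u + Real.pi / L * u := by push_cast; ring
    have h₂ : (2 * (N : ℝ) + 1) * (Real.pi / L) * u =
        (2 * N + 2) * (Real.pi / L) * u - Real.pi / L * u := by ring
    rw [hstep, add_mul, ih, h₁, h₂, Real.sin_add, Real.sin_sub]
    ring

theorem trigPhi_odd (t T : ℝ) (N : ℕ) (s : ℝ) :
    trigPhi t T (2 * N + 1) s =
      Real.sqrt (2 / (T - t)) * Real.sin (2 * Real.pi * ((N + 1 : ℕ) : ℝ) * (s - t) / (T - t)) := by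
  have h₁ : (2 * N + 1) % 2 = 1 := by omega
  have h₂ : (2 * N + 1 + 1) / 2 = N + 1 := by omega
  simp [trigPhi, h₁, h₂]

theorem trigPhi_even (t T : ℝ) (N : ℕ) (s : ℝ) :
    trigPhi t T (2 * N + 2) s =
      Real.sqrt (2 / (T - t)) * Real.cos (2 * Real.pi * ((N + 1 : ℕ) : ℝ) * (s - t) / (T - t)) := by
  have h₁ : (2 * N + 2) % 2 = 0 := by omega
  have h₂ : (2 * N + 2) / 2 = N + 1 := by omega
  simp [trigPhi, h₁, h₂]

theorem continuous_trigPhi (t T : ℝ) (j : ℕ) : Continuous (trigPhi t T j) := by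
  unfold trigPhi
  split_ifs <;> fun_prop

theorem sum_trigPhi_mul_trigPhi {t T : ℝ} (h : t < T) (N : ℕ) (s x : ℝ) :
    ∑ j ∈ Finset.range (2 * N + 1), trigPhi t T j s * trigPhi t T j x =
      dirichletKer (T - t) N (s - x) := by
  have hL : 0 < T - t := sub_pos.2 h
  induction N with
  | zero =>
    simp only [dirichletKer, trigPhi, mul_zero, zero_add, Finset.sum_range_one, if_true,
      Finset.range_zero, Finset.sum_empty, add_zero, mul_one]
    rw [div_mul_div_comm, Real.mul_self_sqrt hL.le, one_mul]
  | succ N ih =>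
    rw [show 2 * (N + 1) + 1 = 2 * N + 1 + 1 + 1 by ring, Finset.sum_range_succ,
      Finset.sum_range_succ, ih, trigPhi_odd, trigPhi_odd, trigPhi_even, trigPhi_even]
    have hsq := Real.mul_self_sqrt (div_nonneg zero_le_two hL.le)
    have hcos : Real.cos (2 * Real.pi * ((N + 1 : ℕ) : ℝ) * (s - x) / (T - t)) =
        Real.cos (2 * Real.pi * ((N + 1 : ℕ) : ℝ) * (s - t) / (T - t)) *
          Real.cos (2 * Real.pi * ((N + 1 : ℕ) : ℝ) * (x - t) / (T - t)) +
        Real.sin (2 * Real.pi * ((N + 1 : ℕ) : ℝ) * (s - t) / (T - t)) *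
          Real.sin (2 * Real.pi * ((N + 1 : ℕ) : ℝ) * (x - t) / (T - t)) := by
      rw [← Real.cos_sub]
      congr 1
      ring
    simp only [dirichletKer, Finset.sum_range_succ, hcos]
    linear_combination (Real.sin (2 * Real.pi * ((N + 1 : ℕ) : ℝ) * (s - t) / (T - t)) *
          Real.sin (2 * Real.pi * ((N + 1 : ℕ) : ℝ) * (x - t) / (T - t)) +
        Real.cos (2 * Real.pi * ((N + 1 : ℕ) : ℝ) * (s - t) / (T - t)) *
          Real.cos (2 * Real.pi * ((N + 1 : ℕ) : ℝ) * (x - t) / (T - t))) * hsq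

/-- Localisation: the Dirichlet kernel asymptotically annihilates functions with a zero at `x`. -/
theorem tendsto_integral_sub_mul_dirichletKer {L : ℝ} (hL : 0 < L) {x a b : ℝ}
    (hab : ∀ s ∈ Set.uIcc a b, |s - x| < L) {e : ℝ → ℝ} (he : ContinuousOn e (Set.uIcc a b)) :
    Tendsto (fun N : ℕ => ∫ s in a..b, (s - x) * e s * dirichletKer L N (s - x)) atTop (𝓝 0) := by
  set d : ℝ → ℝ := dslope (fun u => Real.sin (Real.pi / L * u)) 0 with hd
  have hsin (u : ℝ) : Real.sin (Real.pi / L * u) = u * d u := by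
    have := sub_smul_dslope (fun u => Real.sin (Real.pi / L * u)) 0 u
    simpa using this.symm
  have hdc : Continuous d := by
    rw [← continuousOn_univ, hd, continuousOn_dslope univ_mem]
    exact ⟨by fun_prop, by fun_prop⟩
  have hd0 : ∀ u, |u| < L → d u ≠ 0 := by
    intro u hu h0
    rw [abs_lt] at hu
    rcases eq_or_ne u 0 with rfl | hu0
    · have : HasDerivAt (fun u => Real.sin (Real.pi / L * u)) (Real.pi / L) 0 := by
        simpa using ((hasDerivAt_id (0 : ℝ)).const_mul (Real.pi / L)).sin
      rw [hd, dslope_same, this.deriv] at h0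
      exact (div_pos Real.pi_pos hL).ne' h0
    · have hs := hsin u
      rw [h0, mul_zero] at hs
      have hpL : 0 < Real.pi / L := div_pos Real.pi_pos hL
      have hpi : Real.pi / L * L = Real.pi := div_mul_cancel₀ _ hL.ne'
      have := (Real.sin_eq_zero_iff_of_lt_of_lt (by nlinarith) (by nlinarith)).1 hs
      exact (mul_ne_zero hpL.ne' hu0) this
  have hq : ContinuousOn (fun s => e s / (L * d (s - x))) (Set.uIcc a b) :=
    he.div (by fun_prop) fun s hs => mul_ne_zero hL.ne' (hd0 _ (hab s hs))
  have hw : Tendsto (fun N : ℕ => (2 * (N : ℝ) + 1) * (Real.pi / L)) atTop atTop :=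
    (tendsto_atTop_add_const_right _ _
      (tendsto_natCast_atTop_atTop.const_mul_atTop two_pos)).atTop_mul_const
        (div_pos Real.pi_pos hL)
  refine ((tendsto_intervalIntegral_mul_sin hq x).comp hw).congr fun N => ?_
  refine integral_congr fun s hs => ?_
  have h0 := hd0 _ (hab s hs)
  simp only [← dirichletKer_mul_sin hL, hsin]
  field_simp

theorem tendsto_integral_dirichletKer_half {L : ℝ} (hL : 0 < L) {x b σ : ℝ}
    (hσ : σ = 1 ∨ σ = -1) (hb : 0 < σ * (b - x)) (hbL : σ * (b - x) < L) :
    Tendsto (fun N : ℕ => ∫ s in x..b, dirichletKer L N (s - x)) atTop (𝓝 (σ / 2)) := by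
  have hhalf (N : ℕ) : ∫ s in x..(x + σ * (L / 2)), dirichletKer L N (s - x) = σ / 2 := by
    rw [integral_comp_sub_right (dirichletKer L N) x]
    simp only [sub_self, add_sub_cancel_left, dirichletKer]
    rw [intervalIntegral.integral_const_mul, integral_add (by simp)
      (Continuous.intervalIntegrable (by fun_prop) _ _), intervalIntegral.integral_const_mul,
      intervalIntegral.integral_finsetSum fun k _ => Continuous.intervalIntegrable (by fun_prop) _ _]
    have hcos (k : ℕ) : ∫ u in (0 : ℝ)..(σ * (L / 2)),
        Real.cos (2 * Real.pi * ((k + 1 : ℕ) : ℝ) * u / L) = 0 := by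
      have hk : 2 * Real.pi * ((k + 1 : ℕ) : ℝ) / L ≠ 0 := by positivity
      simp_rw [fun u : ℝ => show 2 * Real.pi * ((k + 1 : ℕ) : ℝ) * u / L =
        2 * Real.pi * ((k + 1 : ℕ) : ℝ) / L * u by ring]
      rw [integral_comp_mul_left _ hk, integral_cos]
      have harg : 2 * Real.pi * ((k + 1 : ℕ) : ℝ) / L * (σ * (L / 2)) =
          σ * (((k + 1 : ℕ) : ℝ) * Real.pi) := by field_simp
      rw [harg]
      have := Real.sin_nat_mul_pi (k + 1)
      rcases hσ with rfl | rfl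
      · simp only [one_mul, this]; simp
      · simp only [neg_mul, one_mul, Real.sin_neg, this]; simp
    simp only [hcos, Finset.sum_const_zero, mul_zero, add_zero, intervalIntegral.integral_const, sub_zero,
      smul_eq_mul, mul_one]
    field_simp
  have hmem : ∀ s ∈ Set.uIcc (x + σ * (L / 2)) b, s - x ≠ 0 ∧ |s - x| < L := by
    intro s hs
    rw [Set.mem_uIcc] at hs
    rcases hσ with rfl | rfl
    · have : 0 < s - x ∧ s - x < L := by
        rcases hs with hs | hs <;> constructor <;> linarith [hs.1, hs.2]
      exact ⟨this.1.ne', by rw [abs_of_pos this.1]; exact this.2⟩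
    · have : s - x < 0 ∧ -(s - x) < L := by
        rcases hs with hs | hs <;> constructor <;> linarith [hs.1, hs.2]
      exact ⟨this.1.ne, by rw [abs_of_neg this.1]; exact this.2⟩
  have hrest := tendsto_integral_sub_mul_dirichletKer hL (x := x) (a := x + σ * (L / 2)) (b := b)
    (fun s hs => (hmem s hs).2) (e := fun s => (s - x)⁻¹)
    (ContinuousOn.inv₀ (by fun_prop) fun s hs => (hmem s hs).1)
  have hlim := hrest.const_add (σ / 2)
  rw [add_zero] at hlim
  refine hlim.congr fun N => ?_
  have hc : Continuous fun s => dirichletKer L N (s - x) :=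
    (continuous_dirichletKer L N).comp (by fun_prop)
  rw [← integral_add_adjacent_intervals (hc.intervalIntegrable x (x + σ * (L / 2)))
    (hc.intervalIntegrable _ b), hhalf]
  congr 1
  refine integral_congr fun s hs => ?_
  simp only [mul_inv_cancel₀ (hmem s hs).1, one_mul]

/-- Convergence of the Dirichlet integrals of a function truncated at `b`. -/
theorem tendsto_integral_mul_dirichletKer {t T x b : ℝ} (hx : x ∈ Set.Ioo t T)
    (hb : b ∈ Set.Ioc t T) {f : ℝ → ℝ} (hf : ContinuousOn f (Set.Icc t T))
    (hfx : DifferentiableAt ℝ f x) :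
    Tendsto (fun N : ℕ => ∫ s in t..b, f s * dirichletKer (T - t) N (s - x)) atTop
      (𝓝 (f x * ((if x < b then (1 : ℝ) else 0) + (if x = b then (1 : ℝ) / 2 else 0)))) := by
  have hL : 0 < T - t := by linarith [hx.1, hx.2]
  have hsub : Set.uIcc t b ⊆ Set.Icc t T := by
    rw [Set.uIcc_of_le hb.1.le]
    exact Set.Icc_subset_Icc_right hb.2
  have hright : Tendsto (fun N : ℕ => ∫ s in x..b, dirichletKer (T - t) N (s - x)) atTop
      (𝓝 ((if x < b then (1 : ℝ) else 0) + (if x = b then (1 : ℝ) / 2 else 0) - 1 / 2)) := by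
    rcases lt_trichotomy x b with hxb | rfl | hxb
    · convert tendsto_integral_dirichletKer_half hL (x := x) (b := b) (σ := 1) (.inl rfl)
        (by linarith) (by linarith [hx.1, hb.2]) using 2
      simp [hxb, hxb.ne]
      norm_num
    · simp
    · convert tendsto_integral_dirichletKer_half hL (x := x) (b := b) (σ := -1) (.inr rfl)
        (by linarith) (by linarith [hx.2, hb.1]) using 2
      simp [hxb.not_gt, hxb.ne']
      norm_num
  have hleft : Tendsto (fun N : ℕ => ∫ s in x..t, dirichletKer (T - t) N (s - x)) atTop
      (𝓝 (-1 / 2)) :=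
    tendsto_integral_dirichletKer_half hL (.inr rfl) (by linarith [hx.1]) (by linarith [hx.2])
  have he : ContinuousOn (dslope f x) (Set.Icc t T) :=
    (continuousOn_dslope (Icc_mem_nhds hx.1 hx.2)).2 ⟨hf, hfx⟩
  have herr := tendsto_integral_sub_mul_dirichletKer hL (x := x) (a := t) (b := b)
    (fun s hs => by
      have := hsub hs
      rw [abs_lt]
      constructor <;> linarith [this.1, this.2, hx.1, hx.2]) (he.mono hsub)
  convert ((hright.sub hleft).const_mul (f x)).add herr using 1
  · ext N
    have hc : Continuous fun s => dirichletKer (T - t) N (s - x) :=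
      (continuous_dirichletKer _ N).comp (by fun_prop)
    have herrc : ContinuousOn (fun s => (s - x) * dslope f x s * dirichletKer (T - t) N (s - x))
        (Set.uIcc t b) := (ContinuousOn.mul (by fun_prop) (he.mono hsub)).mul hc.continuousOn
    rw [integral_interval_sub_left (hc.intervalIntegrable _ _) (hc.intervalIntegrable _ _),
      ← intervalIntegral.integral_const_mul, ← integral_add ((hc.const_mul _).intervalIntegrable _ _)
        herrc.intervalIntegrable]
    refine integral_congr fun s _ => ?_
    have := sub_smul_dslope f x s
    rw [smul_eq_mul] at this
    simp only [this]
    ring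
  · congr 1
    ring

theorem tendsto_of_tendsto_even_of_tendsto_odd {X : Type*} [TopologicalSpace X] {u : ℕ → X} {l : X}
    (he : Tendsto (fun n => u (2 * n)) atTop (𝓝 l))
    (ho : Tendsto (fun n => u (2 * n + 1)) atTop (𝓝 l)) : Tendsto u atTop (𝓝 l) := by
  intro s hs
  obtain ⟨m, hm⟩ := mem_atTop_sets.1 (he hs)
  obtain ⟨n, hn⟩ := mem_atTop_sets.1 (ho hs)
  refine mem_atTop_sets.2 ⟨2 * m + 2 * n, fun k hk => ?_⟩
  rcases Nat.even_or_odd' k with ⟨c, rfl | rfl⟩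
  · exact hm c (by omega)
  · exact hn c (by omega)

/-- Pointwise convergence of the trigonometric Fourier series of a function truncated at `b`. -/
theorem tendsto_sum_integral_mul_trigPhi {t T x b : ℝ} (hx : x ∈ Set.Ioo t T)
    (hb : b ∈ Set.Ioc t T) {f : ℝ → ℝ} (hf : ContinuousOn f (Set.Icc t T))
    (hfx : DifferentiableAt ℝ f x) :
    Tendsto (fun p : ℕ => ∑ j ∈ Finset.range (p + 1),
        (∫ s in t..b, f s * trigPhi t T j s) * trigPhi t T j x) atTop
      (𝓝 (f x * ((if x < b then (1 : ℝ) else 0) + (if x = b then (1 : ℝ) / 2 else 0)))) := by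
  have htT : t < T := hx.1.trans hx.2
  have hL : 0 < T - t := sub_pos.2 htT
  have hfb : ContinuousOn f (Set.uIcc t b) := by
    rw [Set.uIcc_of_le hb.1.le]
    exact hf.mono (Set.Icc_subset_Icc_right hb.2)
  set a : ℕ → ℝ := fun j => (∫ s in t..b, f s * trigPhi t T j s) * trigPhi t T j x with ha
  have heven : Tendsto (fun N : ℕ => ∑ j ∈ Finset.range (2 * N + 1), a j) atTop
      (𝓝 (f x * ((if x < b then (1 : ℝ) else 0) + (if x = b then (1 : ℝ) / 2 else 0)))) := by
    refine (tendsto_integral_mul_dirichletKer hx hb hf hfx).congr fun N => ?_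
    simp only [ha, ← intervalIntegral.integral_mul_const]
    rw [← intervalIntegral.integral_finsetSum]
    · refine integral_congr fun s _ => ?_
      simp only [← sum_trigPhi_mul_trigPhi htT, Finset.mul_sum, mul_assoc]
    · exact fun j _ => ContinuousOn.intervalIntegrable
        ((hfb.mul (continuous_trigPhi t T j).continuousOn).mul continuousOn_const)
  have hodd : Tendsto (fun N : ℕ => a (2 * N + 1)) atTop (𝓝 0) := by
    have hw : Tendsto (fun N : ℕ => 2 * Real.pi / (T - t) * ((N + 1 : ℕ) : ℝ)) atTop atTop :=
      (tendsto_natCast_atTop_atTop.comp (tendsto_add_atTop_nat 1)).const_mul_atTop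
        (div_pos Real.two_pi_pos hL)
    have hlim := ((tendsto_intervalIntegral_mul_sin hfb t).comp hw).mul_const (2 / (T - t))
    rw [zero_mul] at hlim
    refine squeeze_zero_norm (fun N => ?_) (tendsto_zero_iff_norm_tendsto_zero.1 hlim)
    have hcoef : ∫ s in t..b, f s * trigPhi t T (2 * N + 1) s = Real.sqrt (2 / (T - t)) *
        ∫ s in t..b, f s * Real.sin (2 * Real.pi / (T - t) * ((N + 1 : ℕ) : ℝ) * (s - t)) := by
      rw [← intervalIntegral.integral_const_mul]
      refine integral_congr fun s _ => ?_
      simp only [trigPhi_odd]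
      rw [show 2 * Real.pi * ((N + 1 : ℕ) : ℝ) * (s - t) / (T - t) =
        2 * Real.pi / (T - t) * ((N + 1 : ℕ) : ℝ) * (s - t) by ring]
      ring
    have hsq := Real.mul_self_sqrt (div_nonneg zero_le_two hL.le)
    have hfac (I S : ℝ) : Real.sqrt (2 / (T - t)) * I * (Real.sqrt (2 / (T - t)) * S) =
        I * (2 / (T - t)) * S := by linear_combination I * S * hsq
    simp only [ha, Function.comp_apply]
    rw [hcoef, trigPhi_odd, hfac, norm_mul _ (Real.sin _)]
    exact mul_le_of_le_one_right (norm_nonneg _) (Real.abs_sin_le_one _)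
  refine tendsto_of_tendsto_even_of_tendsto_odd heven ?_
  have := heven.add hodd
  rw [add_zero] at this
  exact this.congr fun N => (Finset.sum_range_succ a (2 * N + 1)).symm

/-- on `(t,T)²` the iterated (double) trigonometric Fourier series of `K*`
converges (in the iterated-limit sense) to `K*(t₁,t₂)`. -/
theorem trig_double_fourier_series_Kstar
    (t T : ℝ) (h : t < T) (ψ₁ ψ₂ : ℝ → ℝ)
    (hψ₁ : ContDiffOn ℝ 1 ψ₁ (Set.Icc t T)) (hψ₂ : ContDiffOn ℝ 1 ψ₂ (Set.Icc t T)) :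
    ∀ t₁ ∈ Set.Ioo t T, ∀ t₂ ∈ Set.Ioo t T,
      ∃ g : ℕ → ℝ,
        (∀ p₁ : ℕ,
          Tendsto
            (fun p₂ : ℕ =>
              ∑ j₁ ∈ Finset.range (p₁ + 1), ∑ j₂ ∈ Finset.range (p₂ + 1),
                trigCoef2 t T ψ₁ ψ₂ j₁ j₂ * trigPhi t T j₁ t₁ * trigPhi t T j₂ t₂)
            atTop (nhds (g p₁))) ∧
        Tendsto g atTop (nhds (Kstar2 ψ₁ ψ₂ t₁ t₂)) := by
  intro t₁ ht₁ t₂ ht₂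
  have htT : t ≤ T := h.le
  have hdiff {ψ : ℝ → ℝ} (hψ : ContDiffOn ℝ 1 ψ (Set.Icc t T)) {x : ℝ} (hx : x ∈ Set.Ioo t T) :
      DifferentiableAt ℝ ψ x :=
    (hψ.differentiableOn one_ne_zero).differentiableAt (Icc_mem_nhds hx.1 hx.2)
  refine ⟨fun p₁ => ∑ j₁ ∈ Finset.range (p₁ + 1),
    ψ₂ t₂ * (∫ s in t..t₂, ψ₁ s * trigPhi t T j₁ s) * trigPhi t T j₁ t₁, fun p₁ => ?_, ?_⟩
  · refine tendsto_finsetSum _ fun j₁ _ => ?_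
    have hint : ContinuousOn (fun s => ψ₁ s * trigPhi t T j₁ s) (Set.Icc t T) :=
      hψ₁.continuousOn.mul (continuous_trigPhi t T j₁).continuousOn
    have hprim : ∀ s ∈ Set.Ioo t T,
        HasDerivAt (fun v => ∫ u in t..v, ψ₁ u * trigPhi t T j₁ u) (ψ₁ s * trigPhi t T j₁ s) s := by
      intro s hs
      have hnhds := Icc_mem_nhds hs.1 hs.2
      refine integral_hasDerivAt_right
        ((hint.mono (Set.Icc_subset_Icc_right hs.2.le)).intervalIntegrable_of_Icc hs.1.le)
        ?_ (hint.continuousAt hnhds)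
      exact ⟨Set.Icc t T, hnhds, hint.aestronglyMeasurable measurableSet_Icc⟩
    have hprimc : ContinuousOn (fun v => ∫ u in t..v, ψ₁ u * trigPhi t T j₁ u) (Set.Icc t T) := by
      have := continuousOn_primitive_interval (μ := volume)
        (f := fun s => ψ₁ s * trigPhi t T j₁ s) (a := t) (b := T)
      rw [Set.uIcc_of_le htT] at this
      exact this (hint.integrableOn_Icc)
    have hlim := (tendsto_sum_integral_mul_trigPhi ht₂ (Set.right_mem_Ioc.2 h)
      (hψ₂.continuousOn.mul hprimc)
      ((hdiff hψ₂ ht₂).mul (hprim t₂ ht₂).differentiableAt)).mul_const (trigPhi t T j₁ t₁)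
    rw [if_pos ht₂.2, if_neg ht₂.2.ne, add_zero, mul_one] at hlim
    refine hlim.congr fun p₂ => ?_
    rw [Finset.sum_mul]
    refine Finset.sum_congr rfl fun j₂ _ => ?_
    rw [mul_right_comm, trigCoef2]
    congr 2
    refine integral_congr fun s _ => ?_
    exact mul_right_comm _ _ _
  · convert (tendsto_sum_integral_mul_trigPhi ht₁ ⟨ht₂.1, ht₂.2.le⟩ hψ₁.continuousOn
      (hdiff hψ₁ ht₁)).const_mul (ψ₂ t₂) using 1
    · ext p₁
      simp only [Finset.mul_sum, mul_assoc]
    · congr 1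
      rw [Kstar2]
      ring
end

section
/- Let t < T and let {φ_j}_{j=0}^∞ be the Legendre system on [t,T]. Define D_{j_1 j_2} = ∫_t^T φ_{j_2}(y)·(∫_t^y φ_{j_1}(x) dx) dy. Then D_{00} = (T−t)/2; for every integer i ≥ 1: D_{i−1,i} = (T−t)/(2·√(4i²−1)), D_{i,i−1} = −(T−t)/(2·√(4i²−1)), and D_{ii} = 0; and D_{j_1 j_2} = 0 whenever |j_1 − j_2| ≥ 2. -/
open MeasureTheory intervalIntegral

/-- The `j`-th Legendre polynomial via Rodrigues' formula. -/
noncomputable def legendreP (j : ℕ) (y : ℝ) : ℝ :=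
  (1 / (2 ^ j * (Nat.factorial j : ℝ))) * iteratedDeriv j (fun z : ℝ => (z ^ 2 - 1) ^ j) y

/-- The Legendre system on `[t, T]`. -/
noncomputable def legendrePhi (t T : ℝ) (j : ℕ) (x : ℝ) : ℝ :=
  Real.sqrt ((2 * (j : ℝ) + 1) / (T - t)) * legendreP j ((x - (T + t) / 2) * (2 / (T - t)))

/-- `D_{j₁ j₂} = ∫_t^T φ_{j₂}(y) (∫_t^y φ_{j₁}(x) dx) dy` for the Legendre system. -/
noncomputable def legendreD (t T : ℝ) (j₁ j₂ : ℕ) : ℝ :=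
  ∫ y in t..T, legendrePhi t T j₂ y * ∫ x in t..y, legendrePhi t T j₁ x

open Polynomial in
/-- The `n`-th Legendre polynomial as an element of `ℝ[X]`. -/
noncomputable def legendrePoly (n : ℕ) : ℝ[X] :=
  C (1 / (2 ^ n * (Nat.factorial n : ℝ))) * derivative^[n] ((X ^ 2 - 1) ^ n)

open Polynomial in
/-- The antiderivative of `legendrePoly n` that vanishes at `-1`. -/
noncomputable def legendreAntideriv : ℕ → ℝ[X]
  | 0 => X + 1
  | n + 1 => C (1 / (2 ^ (n + 1) * (Nat.factorial (n + 1) : ℝ))) *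
      derivative^[n] ((X ^ 2 - 1) ^ (n + 1))

section LegendrePolynomial

open Polynomial

theorem iteratedDeriv_polynomial_eval (p : ℝ[X]) (k : ℕ) (y : ℝ) :
    iteratedDeriv k (fun z => p.eval z) y = (derivative^[k] p).eval y := by
  induction k generalizing y with
  | zero => simp
  | succ k ih =>
    rw [iteratedDeriv_succ, funext ih, Polynomial.deriv, Function.iterate_succ_apply']

theorem legendreP_eq_eval (n : ℕ) (y : ℝ) : legendreP n y = (legendrePoly n).eval y := by
  have := iteratedDeriv_polynomial_eval ((X ^ 2 - 1) ^ n) n y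
  simp only [eval_pow, eval_sub, eval_X, eval_one] at this
  rw [legendreP, legendrePoly, this, eval_mul, eval_C]

theorem legendrePoly_zero : legendrePoly 0 = 1 := by simp [legendrePoly]

theorem eval_iterate_derivative_eq_zero {n k : ℕ} (hk : k < n) {x : ℝ} (hx : x ^ 2 = 1) :
    (derivative^[k] ((X ^ 2 - 1 : ℝ[X]) ^ n)).eval x = 0 := by
  have hdvd : (X - C x) ^ n ∣ (X ^ 2 - 1 : ℝ[X]) ^ n :=
    pow_dvd_pow_of_dvd (dvd_iff_isRoot.mpr (by simp [hx])) n
  have := pow_sub_dvd_iterate_derivative_of_pow_dvd k hdvd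
  exact dvd_iff_isRoot.mp ((dvd_pow_self _ (by omega)).trans this)

theorem derivative_legendreAntideriv (n : ℕ) :
    derivative (legendreAntideriv n) = legendrePoly n := by
  cases n with
  | zero => simp [legendreAntideriv, legendrePoly_zero]
  | succ n => rw [legendreAntideriv, legendrePoly, derivative_C_mul, Function.iterate_succ_apply']

theorem legendreAntideriv_eval_neg_one (n : ℕ) : (legendreAntideriv n).eval (-1) = 0 := by
  cases n with
  | zero => simp [legendreAntideriv]
  | succ n =>
    rw [legendreAntideriv, eval_mul, eval_iterate_derivative_eq_zero n.lt_succ_self (by norm_num),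
      mul_zero]

theorem legendreAntideriv_succ_eval_one (n : ℕ) : (legendreAntideriv (n + 1)).eval 1 = 0 := by
  rw [legendreAntideriv, eval_mul, eval_iterate_derivative_eq_zero n.lt_succ_self (by norm_num),
    mul_zero]

theorem legendreAntideriv_zero_eq :
    legendreAntideriv 0 = legendrePoly 1 + legendrePoly 0 := by
  have : (C (1 / 2) : ℝ[X]) * (C 2 * X) = X := by
    rw [← mul_assoc, ← C_mul]
    norm_num
  simpa [legendreAntideriv, legendrePoly, one_add_one_eq_two] using this.symm

theorem legendreAntideriv_succ_eq (n : ℕ) :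
    C (2 * (n : ℝ) + 3) * legendreAntideriv (n + 1) = legendrePoly (n + 2) - legendrePoly n := by
  have hD : derivative^[2] ((X ^ 2 - 1 : ℝ[X]) ^ (n + 2)) =
      C (2 * ((n : ℝ) + 2) * (2 * n + 3)) * (X ^ 2 - 1) ^ (n + 1) +
        C (4 * ((n : ℝ) + 2) * (n + 1)) * (X ^ 2 - 1) ^ n := by
    have c2 : (C 2 : ℝ[X]) = 2 := C_ofNat 2
    have c3 : (C 3 : ℝ[X]) = 3 := C_ofNat 3
    have c4 : (C 4 : ℝ[X]) = 4 := C_ofNat 4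
    simp [derivative_pow, c2, c3, c4]
    ring
  rw [legendreAntideriv, legendrePoly, legendrePoly, Function.iterate_add_apply, hD,
    iterate_map_add, iterate_derivative_C_mul, iterate_derivative_C_mul, mul_add,
    ← mul_assoc, ← mul_assoc, ← mul_assoc, ← C_mul, ← C_mul, ← C_mul]
  have hf : (Nat.factorial n : ℝ) ≠ 0 := by positivity
  have h1 : 1 / (2 ^ (n + 2) * ((n + 2).factorial : ℝ)) * (4 * ((n : ℝ) + 2) * (n + 1)) =
      1 / (2 ^ n * (n.factorial : ℝ)) := by
    simp only [Nat.factorial_succ, Nat.cast_mul, pow_succ]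
    push_cast
    field_simp
    ring
  have h2 : 1 / (2 ^ (n + 2) * ((n + 2).factorial : ℝ)) * (2 * ((n : ℝ) + 2) * (2 * n + 3)) =
      (2 * n + 3) * (1 / (2 ^ (n + 1) * ((n + 1).factorial : ℝ))) := by
    simp only [Nat.factorial_succ, Nat.cast_mul, pow_succ]
    push_cast
    field_simp
    ring
  rw [h1, h2, add_sub_cancel_right]

theorem intervalIntegrable_polynomial_eval (p : ℝ[X]) (a b : ℝ) :
    IntervalIntegrable (fun x => p.eval x) volume a b :=
  p.continuous.intervalIntegrable a b

theorem integral_eval_mul_derivative (p q : ℝ[X]) (a b : ℝ) :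
    ∫ x in a..b, (p * derivative q).eval x =
      (p * q).eval b - (p * q).eval a - ∫ x in a..b, (derivative p * q).eval x := by
  simp only [eval_mul]
  exact integral_mul_deriv_eq_deriv_mul (fun x _ => p.hasDerivAt x) (fun x _ => q.hasDerivAt x)
    (intervalIntegrable_polynomial_eval _ a b) (intervalIntegrable_polynomial_eval _ a b)

theorem integral_mul_iterate_derivative_eq_zero {n k : ℕ} (hk : k ≤ n) {q : ℝ[X]}
    (hq : derivative^[k] q = 0) :
    ∫ x in (-1 : ℝ)..1, (q * derivative^[k] ((X ^ 2 - 1) ^ n)).eval x = 0 := by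
  induction k generalizing q with
  | zero =>
    have : q = 0 := hq
    simp [this]
  | succ k ih =>
    rw [Function.iterate_succ_apply', integral_eval_mul_derivative,
      ih (by omega) (by rwa [← Function.iterate_succ_apply]), eval_mul, eval_mul,
      eval_iterate_derivative_eq_zero hk (by norm_num),
      eval_iterate_derivative_eq_zero hk (by norm_num)]
    ring

theorem natDegree_legendrePoly_le (n : ℕ) : (legendrePoly n).natDegree ≤ n := by
  have h2 : (X ^ 2 - 1 : ℝ[X]).natDegree ≤ 2 := by compute_degree
  have h1 := natDegree_pow_le_of_le n h2
  have h3 := natDegree_iterate_derivative ((X ^ 2 - 1 : ℝ[X]) ^ n) n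
  refine (natDegree_C_mul_le _ _).trans ?_
  omega

theorem integral_legendrePoly_mul_of_lt {m n : ℕ} (h : m < n) :
    ∫ x in (-1 : ℝ)..1, (legendrePoly m * legendrePoly n).eval x = 0 := by
  have hm : derivative^[n] (legendrePoly m) = 0 :=
    iterate_derivative_eq_zero ((natDegree_legendrePoly_le m).trans_lt h)
  have := integral_mul_iterate_derivative_eq_zero le_rfl hm
  rw [legendrePoly.eq_def n, mul_left_comm]
  simp only [eval_C_mul, intervalIntegral.integral_const_mul, this, mul_zero]

theorem integral_legendrePoly_mul_of_ne {m n : ℕ} (h : m ≠ n) :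
    ∫ x in (-1 : ℝ)..1, (legendrePoly m * legendrePoly n).eval x = 0 := by
  rcases h.lt_or_gt with h | h
  · exact integral_legendrePoly_mul_of_lt h
  · rw [mul_comm]
    exact integral_legendrePoly_mul_of_lt h

theorem integral_mul_legendreAntideriv_zero (m : ℕ) :
    ∫ x in (-1 : ℝ)..1, (legendrePoly m * legendreAntideriv 0).eval x =
      (∫ x in (-1 : ℝ)..1, (legendrePoly m * legendrePoly 1).eval x) +
        ∫ x in (-1 : ℝ)..1, (legendrePoly m * legendrePoly 0).eval x := by
  rw [legendreAntideriv_zero_eq]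
  simp only [mul_add, eval_add]
  exact intervalIntegral.integral_add (intervalIntegrable_polynomial_eval _ _ _)
    (intervalIntegrable_polynomial_eval _ _ _)

theorem integral_mul_legendreAntideriv_succ (m n : ℕ) :
    (2 * (n : ℝ) + 3) * ∫ x in (-1 : ℝ)..1, (legendrePoly m * legendreAntideriv (n + 1)).eval x =
      (∫ x in (-1 : ℝ)..1, (legendrePoly m * legendrePoly (n + 2)).eval x) -
        ∫ x in (-1 : ℝ)..1, (legendrePoly m * legendrePoly n).eval x := by
  rw [← intervalIntegral.integral_const_mul, ← intervalIntegral.integral_sub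
    (intervalIntegrable_polynomial_eval _ _ _) (intervalIntegrable_polynomial_eval _ _ _)]
  simp only [← eval_C_mul, ← eval_sub, ← mul_sub, ← legendreAntideriv_succ_eq, mul_left_comm]

theorem integral_legendrePoly_mul_antideriv_antisymm (n : ℕ) :
    ∫ x in (-1 : ℝ)..1, (legendrePoly n * legendreAntideriv (n + 1)).eval x =
      -∫ x in (-1 : ℝ)..1, (legendrePoly (n + 1) * legendreAntideriv n).eval x := by
  have := integral_eval_mul_derivative (legendreAntideriv (n + 1)) (legendreAntideriv n) (-1) 1
  rw [eval_mul, eval_mul, legendreAntideriv_succ_eval_one, legendreAntideriv_eval_neg_one,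
    derivative_legendreAntideriv, derivative_legendreAntideriv, mul_comm] at this
  rw [this]
  ring

theorem integral_legendrePoly_sq (n : ℕ) :
    ∫ x in (-1 : ℝ)..1, (legendrePoly n * legendrePoly n).eval x = 2 / (2 * n + 1) := by
  induction n with
  | zero => simp [legendrePoly_zero]; norm_num
  | succ n ih =>
    have h1 := integral_mul_legendreAntideriv_succ n n
    rw [integral_legendrePoly_mul_of_ne (by omega), ih,
      integral_legendrePoly_mul_antideriv_antisymm] at h1
    have h2 : (2 * (n : ℝ) + 1) * ∫ x in (-1 : ℝ)..1,
        (legendrePoly (n + 1) * legendreAntideriv n).eval x =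
        ∫ x in (-1 : ℝ)..1, (legendrePoly (n + 1) * legendrePoly (n + 1)).eval x := by
      cases n with
      | zero =>
        rw [integral_mul_legendreAntideriv_zero,
          integral_legendrePoly_mul_of_ne (m := 0 + 1) (n := 0) (by omega)]
        simp
      | succ k =>
        have := integral_mul_legendreAntideriv_succ (k + 1 + 1) k
        rw [integral_legendrePoly_mul_of_ne (m := k + 1 + 1) (n := k) (by omega)] at this
        rw [sub_zero] at this
        rw [← this]
        push_cast
        ring
    rw [← h2]
    push_cast
    field_simp at h1 ⊢
    linarith

theorem integral_legendrePoly_mul (m n : ℕ) :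
    ∫ x in (-1 : ℝ)..1, (legendrePoly m * legendrePoly n).eval x =
      if m = n then 2 / (2 * (n : ℝ) + 1) else 0 := by
  split_ifs with h
  · rw [h, integral_legendrePoly_sq]
  · exact integral_legendrePoly_mul_of_ne h

theorem integral_eval_affine (p : ℝ[X]) {t T : ℝ} (h : t < T) (y : ℝ) :
    ∫ x in t..y, p.eval ((x - (T + t) / 2) * (2 / (T - t))) =
      (T - t) / 2 * ∫ u in (-1 : ℝ)..((y - (T + t) / 2) * (2 / (T - t))), p.eval u := by
  have hT : T - t ≠ 0 := (sub_pos.mpr h).ne'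
  have key := intervalIntegral.integral_comp_mul_sub (a := t) (b := y) (fun u => p.eval u)
    (div_ne_zero two_ne_zero hT) ((T + t) / 2 * (2 / (T - t)))
  simp only [smul_eq_mul, inv_div] at key
  have e : (2 / (T - t)) * t - (T + t) / 2 * (2 / (T - t)) = -1 := by
    field_simp
    ring
  rw [e] at key
  simp only [mul_comm _ (2 / (T - t)), mul_sub] at key ⊢
  exact key

theorem integral_legendrePoly (n : ℕ) (y : ℝ) :
    ∫ u in (-1 : ℝ)..y, (legendrePoly n).eval u = (legendreAntideriv n).eval y := by
  rw [← derivative_legendreAntideriv, intervalIntegral.integral_eq_sub_of_hasDerivAt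
    (fun x _ => (legendreAntideriv n).hasDerivAt x) (intervalIntegrable_polynomial_eval _ _ _),
    legendreAntideriv_eval_neg_one, sub_zero]

theorem legendreD_eq {t T : ℝ} (h : t < T) (m n : ℕ) :
    legendreD t T m n = (T - t) / 4 * (Real.sqrt (2 * m + 1) * Real.sqrt (2 * n + 1)) *
      ∫ u in (-1 : ℝ)..1, (legendrePoly n * legendreAntideriv m).eval u := by
  have hT : 0 < T - t := sub_pos.mpr h
  have e : (T - (T + t) / 2) * (2 / (T - t)) = 1 := by
    field_simp
    ring
  have key := integral_eval_affine (legendrePoly n * legendreAntideriv m) h T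
  rw [e] at key
  have hinner (y : ℝ) : legendrePhi t T n y * ∫ x in t..y, legendrePhi t T m x =
      Real.sqrt ((2 * n + 1) / (T - t)) * Real.sqrt ((2 * m + 1) / (T - t)) * ((T - t) / 2) *
        (legendrePoly n * legendreAntideriv m).eval ((y - (T + t) / 2) * (2 / (T - t))) := by
    simp only [legendrePhi, legendreP_eq_eval, intervalIntegral.integral_const_mul]
    rw [integral_eval_affine _ h, integral_legendrePoly, eval_mul]
    ring
  have hs : Real.sqrt (T - t) ^ 2 = T - t := Real.sq_sqrt hT.le
  have hs0 : Real.sqrt (T - t) ≠ 0 := (Real.sqrt_pos.mpr hT).ne'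
  simp only [legendreD, hinner, intervalIntegral.integral_const_mul, key]
  rw [Real.sqrt_div' _ hT.le, Real.sqrt_div' _ hT.le]
  field_simp
  rw [hs]
  ring

theorem integral_legendrePoly_mul_antideriv (m n : ℕ) :
    ∫ u in (-1 : ℝ)..1, (legendrePoly n * legendreAntideriv m).eval u =
      if m = 0 ∧ n = 0 then 2
      else if n = m + 1 then 2 / ((2 * (m : ℝ) + 1) * (2 * n + 1))
      else if m = n + 1 then -(2 / ((2 * (m : ℝ) + 1) * (2 * n + 1)))
      else 0 := by
  cases m with
  | zero =>
    rw [integral_mul_legendreAntideriv_zero, integral_legendrePoly_mul, integral_legendrePoly_mul]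
    rcases n with _ | _ | n <;> norm_num
  | succ m =>
    have h := integral_mul_legendreAntideriv_succ n m
    rw [integral_legendrePoly_mul, integral_legendrePoly_mul] at h
    have h0 : 2 * (m : ℝ) + 3 ≠ 0 := by positivity
    rw [← mul_right_inj' h0, h]
    by_cases h1 : n = m + 2
    · subst h1
      simp
      field_simp
      ring
    · by_cases h2 : n = m
      · subst h2
        simp [show ¬n = n + 1 + 1 by omega]
        field_simp
        ring
      · simp [h1, h2, Ne.symm h2]

theorem div_four_mul_sqrt_mul_sqrt (c : ℝ) (n : ℕ) :
    c / 4 * (Real.sqrt (2 * n + 1) * Real.sqrt (2 * (n + 1 : ℕ) + 1)) *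
      (2 / ((2 * n + 1) * (2 * (n + 1 : ℕ) + 1))) =
      c / (2 * Real.sqrt (4 * ((n + 1 : ℕ) : ℝ) ^ 2 - 1)) := by
  have ha : (0 : ℝ) < (2 * n + 1) * (2 * (n + 1 : ℕ) + 1) := by positivity
  have e : 4 * ((n + 1 : ℕ) : ℝ) ^ 2 - 1 = (2 * n + 1) * (2 * (n + 1 : ℕ) + 1) := by
    push_cast
    ring
  have hs := Real.sq_sqrt ha.le
  have hs0 := (Real.sqrt_pos.mpr ha).ne'
  rw [e, ← Real.sqrt_mul (by positivity)]
  generalize Real.sqrt _ = s at hs hs0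
  rw [← hs]
  field_simp
  norm_num

end LegendrePolynomial

/-- values of `D_{j₁ j₂}` for the Legendre system:
`D₀₀ = (T−t)/2`; for `i ≥ 1`, `D_{i−1,i} = (T−t)/(2√(4i²−1))`,
`D_{i,i−1} = −(T−t)/(2√(4i²−1))`, `D_{ii} = 0`; and `D_{j₁ j₂} = 0` if `|j₁−j₂| ≥ 2`. -/
theorem legendreD_values (t T : ℝ) (h : t < T) :
    legendreD t T 0 0 = (T - t) / 2 ∧
    (∀ i : ℕ, 1 ≤ i →
      legendreD t T (i - 1) i = (T - t) / (2 * Real.sqrt (4 * (i : ℝ) ^ 2 - 1)) ∧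
      legendreD t T i (i - 1) = -((T - t) / (2 * Real.sqrt (4 * (i : ℝ) ^ 2 - 1))) ∧
      legendreD t T i i = 0) ∧
    (∀ j₁ j₂ : ℕ, 2 ≤ |(j₁ : ℤ) - (j₂ : ℤ)| → legendreD t T j₁ j₂ = 0) := by
  refine ⟨?_, ?_, ?_⟩
  · rw [legendreD_eq h, integral_legendrePoly_mul_antideriv]
    norm_num
    ring
  · rintro (_ | n) hi
    · omega
    refine ⟨?_, ?_, ?_⟩
    · rw [legendreD_eq h, integral_legendrePoly_mul_antideriv, Nat.add_sub_cancel,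
        if_neg (by omega), if_pos rfl, div_four_mul_sqrt_mul_sqrt]
    · rw [legendreD_eq h, integral_legendrePoly_mul_antideriv, Nat.add_sub_cancel,
        if_neg (by omega), if_neg (by omega), if_pos rfl, ← div_four_mul_sqrt_mul_sqrt]
      ring
    · rw [legendreD_eq h, integral_legendrePoly_mul_antideriv, if_neg (by omega),
        if_neg (by omega), if_neg (by omega), mul_zero]
  · intro m n hmn
    rw [le_abs] at hmn
    rw [legendreD_eq h, integral_legendrePoly_mul_antideriv, if_neg (by omega),
      if_neg (by omega), if_neg (by omega), mul_zero]
end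

section
/- Let t < T and let {φ_j}_{j=0}^∞ be the trigonometric system on [t,T]. Define D_{j_1 j_2} = ∫_t^T φ_{j_2}(y)·(∫_t^y φ_{j_1}(x) dx) dy. Then D_{00} = (T−t)/2; for every integer r ≥ 1: D_{2r,2r−1} = (T−t)/(2πr), D_{2r−1,2r} = −(T−t)/(2πr), D_{2r−1,0} = √2·(T−t)/(2πr), and D_{0,2r−1} = −√2·(T−t)/(2πr); and D_{j_1 j_2} = 0 for every other pair (j_1,j_2) (i.e., every pair not of one of the five forms above). -/
open MeasureTheory intervalIntegral

/-- `D_{j₁ j₂} = ∫_t^T φ_{j₂}(y) (∫_t^y φ_{j₁}(x) dx) dy` for the trigonometric system. -/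
noncomputable def trigD (t T : ℝ) (j₁ j₂ : ℕ) : ℝ :=
  ∫ y in t..T, trigPhi t T j₂ y * ∫ x in t..y, trigPhi t T j₁ x

open Real in
theorem integral_cos_int_mul (k : ℤ) :
    ∫ x in (0 : ℝ)..2 * π, cos (k * x) = if k = 0 then 2 * π else 0 := by
  split_ifs with hk
  · simp [hk]
  · have hk' : (k : ℝ) ≠ 0 := by exact_mod_cast hk
    rw [integral_comp_mul_left (fun x => cos x) hk', integral_cos]
    have h2 : sin ((k : ℝ) * (2 * π)) = 0 := by
      have := sin_int_mul_pi (2 * k)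
      push_cast at this
      rw [← this]; ring_nf
    simp [h2]

open Real in
theorem integral_sin_int_mul (k : ℤ) : ∫ x in (0 : ℝ)..2 * π, sin (k * x) = 0 := by
  by_cases hk : k = 0
  · simp [hk]
  · have hk' : (k : ℝ) ≠ 0 := by exact_mod_cast hk
    rw [integral_comp_mul_left (fun x => sin x) hk', integral_sin]
    simp [cos_int_mul_two_pi]

open Real in
theorem integral_sin_nat_mul (r : ℕ) : ∫ x in (0 : ℝ)..2 * π, sin (r * x) = 0 := by
  exact_mod_cast integral_sin_int_mul r

open Real in
theorem integral_cos_nat_mul {r : ℕ} (hr : 1 ≤ r) : ∫ x in (0 : ℝ)..2 * π, cos (r * x) = 0 := by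
  have := integral_cos_int_mul r
  rw [if_neg (by omega)] at this
  exact_mod_cast this

open Real in
theorem integral_sin_mul_sin_nat {r s : ℕ} (hr : 1 ≤ r) :
    ∫ x in (0 : ℝ)..2 * π, sin (r * x) * sin (s * x) = if r = s then π else 0 := by
  have e : ∀ x : ℝ, sin (r * x) * sin (s * x) =
      (cos (((r - s : ℤ) : ℝ) * x) - cos (((r + s : ℤ) : ℝ) * x)) / 2 := fun x => by
    push_cast; rw [sub_mul, add_mul, cos_sub, cos_add]; ring
  simp_rw [e]
  rw [intervalIntegral.integral_div, intervalIntegral.integral_sub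
    (Continuous.intervalIntegrable (by fun_prop) _ _)
    (Continuous.intervalIntegrable (by fun_prop) _ _), integral_cos_int_mul, integral_cos_int_mul,
    if_neg (by omega : ¬ (r + s : ℤ) = 0)]
  by_cases hrs : r = s
  · simp [hrs]
  · rw [if_neg (by omega), if_neg hrs]; simp

open Real in
theorem integral_cos_mul_cos_nat {r s : ℕ} (hr : 1 ≤ r) :
    ∫ x in (0 : ℝ)..2 * π, cos (r * x) * cos (s * x) = if r = s then π else 0 := by
  have e : ∀ x : ℝ, cos (r * x) * cos (s * x) =
      (cos (((r - s : ℤ) : ℝ) * x) + cos (((r + s : ℤ) : ℝ) * x)) / 2 := fun x => by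
    push_cast; rw [sub_mul, add_mul, cos_sub, cos_add]; ring
  simp_rw [e]
  rw [intervalIntegral.integral_div, intervalIntegral.integral_add
    (Continuous.intervalIntegrable (by fun_prop) _ _)
    (Continuous.intervalIntegrable (by fun_prop) _ _), integral_cos_int_mul, integral_cos_int_mul,
    if_neg (by omega : ¬ (r + s : ℤ) = 0)]
  by_cases hrs : r = s
  · simp [hrs]
  · rw [if_neg (by omega), if_neg hrs]; simp

open Real in
theorem integral_sin_mul_cos_nat (r s : ℕ) :
    ∫ x in (0 : ℝ)..2 * π, sin (r * x) * cos (s * x) = 0 := by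
  have e : ∀ x : ℝ, sin (r * x) * cos (s * x) =
      (sin (((r - s : ℤ) : ℝ) * x) + sin (((r + s : ℤ) : ℝ) * x)) / 2 := fun x => by
    push_cast; rw [sub_mul, add_mul, sin_sub, sin_add]; ring
  simp_rw [e]
  rw [intervalIntegral.integral_div, intervalIntegral.integral_add
    (Continuous.intervalIntegrable (by fun_prop) _ _)
    (Continuous.intervalIntegrable (by fun_prop) _ _), integral_sin_int_mul, integral_sin_int_mul]
  simp

open Real in
theorem integral_sin_nat_mul_zero_left {r : ℕ} (hr : 1 ≤ r) (y : ℝ) :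
    ∫ x in (0 : ℝ)..y, sin (r * x) = (1 - cos (r * y)) / r := by
  have hr' : (r : ℝ) ≠ 0 := by positivity
  rw [integral_comp_mul_left (fun x => sin x) hr', integral_sin]
  simp; ring

open Real in
theorem integral_cos_nat_mul_zero_left {r : ℕ} (hr : 1 ≤ r) (y : ℝ) :
    ∫ x in (0 : ℝ)..y, cos (r * x) = sin (r * y) / r := by
  have hr' : (r : ℝ) ≠ 0 := by positivity
  rw [integral_comp_mul_left (fun x => cos x) hr', integral_cos]
  simp; ring

open Real in
theorem integral_sin_nat_mul_mul_self {r : ℕ} (hr : 1 ≤ r) :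
    ∫ x in (0 : ℝ)..2 * π, sin (r * x) * x = -(2 * π / r) := by
  have hr' : (r : ℝ) ≠ 0 := by positivity
  rw [integral_eq_sub_of_hasDerivAt (f := fun x => sin (r * x) / r ^ 2 - x * cos (r * x) / r)
    (fun x _ => ?_) (Continuous.intervalIntegrable (by fun_prop) _ _)]
  · have h2 : sin ((r : ℝ) * (2 * π)) = 0 := by
      simpa [mul_assoc, mul_comm, mul_left_comm] using sin_nat_mul_pi (2 * r)
    simp [h2, cos_nat_mul_two_pi]
  · have h1 := (hasDerivAt_id x).const_mul (r : ℝ)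
    refine ((h1.sin.div_const ((r : ℝ) ^ 2)).sub
      (((hasDerivAt_id x).mul h1.cos).div_const (r : ℝ))).congr_deriv ?_
    simp only [id]
    field_simp
    ring

open Real in
theorem integral_cos_nat_mul_mul_self {r : ℕ} (hr : 1 ≤ r) :
    ∫ x in (0 : ℝ)..2 * π, cos (r * x) * x = 0 := by
  have hr' : (r : ℝ) ≠ 0 := by positivity
  rw [integral_eq_sub_of_hasDerivAt (f := fun x => cos (r * x) / r ^ 2 + x * sin (r * x) / r)
    (fun x _ => ?_) (Continuous.intervalIntegrable (by fun_prop) _ _)]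
  · have h2 : sin ((r : ℝ) * (2 * π)) = 0 := by
      simpa [mul_assoc, mul_comm, mul_left_comm] using sin_nat_mul_pi (2 * r)
    simp [h2, cos_nat_mul_two_pi]
  · have h1 := (hasDerivAt_id x).const_mul (r : ℝ)
    refine ((h1.cos.div_const ((r : ℝ) ^ 2)).add
      (((hasDerivAt_id x).mul h1.sin).div_const (r : ℝ))).congr_deriv ?_
    simp only [id]
    field_simp
    ring

/-- The trigonometric system on `[0, 2π]`, scaled so that each function has mean square `1`. -/
noncomputable def trigPsi (j : ℕ) (x : ℝ) : ℝ :=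
  if j = 0 then 1
  else if j % 2 = 1 then √2 * Real.sin (((j + 1) / 2 : ℕ) * x)
  else √2 * Real.cos ((j / 2 : ℕ) * x)

theorem trigPsi_zero (x : ℝ) : trigPsi 0 x = 1 := by simp [trigPsi]

theorem trigPsi_two_mul_sub_one {r : ℕ} (hr : 1 ≤ r) (x : ℝ) :
    trigPsi (2 * r - 1) x = √2 * Real.sin (r * x) := by
  rw [trigPsi, if_neg (by omega), if_pos (by omega), show (2 * r - 1 + 1) / 2 = r by omega]

theorem trigPsi_two_mul {r : ℕ} (hr : 1 ≤ r) (x : ℝ) :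
    trigPsi (2 * r) x = √2 * Real.cos (r * x) := by
  rw [trigPsi, if_neg (by omega), if_neg (by omega), show 2 * r / 2 = r by omega]

theorem trigPhi_eq_trigPsi {t T : ℝ} (h : t < T) (j : ℕ) (s : ℝ) :
    trigPhi t T j s =
      1 / √(T - t) * trigPsi j (2 * Real.pi / (T - t) * s - 2 * Real.pi / (T - t) * t) := by
  have hL : T - t ≠ 0 := by linarith
  have e : ∀ r : ℕ, 2 * Real.pi * (r : ℝ) * (s - t) / (T - t) =
      r * (2 * Real.pi / (T - t) * s - 2 * Real.pi / (T - t) * t) := fun r => by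
    field_simp
  unfold trigPhi trigPsi
  split_ifs
  · simp
  all_goals rw [e, Real.sqrt_div (by norm_num)]; ring

open Real in
theorem trigD_eq_integral_trigPsi {t T : ℝ} (h : t < T) (j₁ j₂ : ℕ) :
    trigD t T j₁ j₂ = (T - t) / (4 * π ^ 2) *
      ∫ y in (0 : ℝ)..2 * π, trigPsi j₂ y * ∫ x in (0 : ℝ)..y, trigPsi j₁ x := by
  have hL : 0 < T - t := by linarith
  set c := 2 * π / (T - t) with hc
  have hc0 : c ≠ 0 := by positivity
  have inner (y : ℝ) : ∫ x in t..y, trigPhi t T j₁ x =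
      1 / √(T - t) * (c⁻¹ * ∫ x in (0 : ℝ)..(c * y - c * t), trigPsi j₁ x) := by
    simp_rw [trigPhi_eq_trigPsi h, ← hc, intervalIntegral.integral_const_mul]
    rw [integral_comp_mul_sub (trigPsi j₁) hc0, sub_self, smul_eq_mul]
  have hsq : √(T - t) ^ 2 = T - t := sq_sqrt hL.le
  have e (y : ℝ) : trigPhi t T j₂ y * ∫ x in t..y, trigPhi t T j₁ x =
      c⁻¹ / (T - t) * (fun z => trigPsi j₂ z * ∫ x in (0 : ℝ)..z, trigPsi j₁ x) (c * y - c * t) := by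
    rw [inner, trigPhi_eq_trigPsi h]
    nth_rewrite 5 [← hsq]
    ring
  have hT : c * T - c * t = 2 * π := by rw [hc]; field_simp
  simp_rw [trigD, e, intervalIntegral.integral_const_mul]
  rw [integral_comp_mul_sub (fun z => trigPsi j₂ z * ∫ x in (0 : ℝ)..z, trigPsi j₁ x) hc0, hT,
    sub_self, smul_eq_mul, ← mul_assoc]
  congr 1
  rw [hc]
  field_simp
  norm_num

section Values

open Real

variable {t T : ℝ} (h : t < T) {r s : ℕ} (hr : 1 ≤ r) (hs : 1 ≤ s)
include h

theorem trigD_zero_zero : trigD t T 0 0 = (T - t) / 2 := by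
  simp only [trigD_eq_integral_trigPsi h, trigPsi_zero]
  simp
  field_simp
  norm_num

include hr

theorem trigD_zero_odd : trigD t T 0 (2 * r - 1) = -(√2 * (T - t) / (2 * π * r)) := by
  have hr' : (r : ℝ) ≠ 0 := by positivity
  simp only [trigD_eq_integral_trigPsi h, trigPsi_zero, trigPsi_two_mul_sub_one hr, mul_assoc,
    intervalIntegral.integral_const_mul]
  simp only [intervalIntegral.integral_const, sub_zero, smul_eq_mul, mul_one,
    integral_sin_nat_mul_mul_self hr]
  field_simp
  norm_num

theorem trigD_zero_even : trigD t T 0 (2 * r) = 0 := by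
  simp only [trigD_eq_integral_trigPsi h, trigPsi_zero, trigPsi_two_mul hr, mul_assoc,
    intervalIntegral.integral_const_mul]
  simp [integral_cos_nat_mul_mul_self hr]

theorem trigD_odd_zero : trigD t T (2 * r - 1) 0 = √2 * (T - t) / (2 * π * r) := by
  have hr' : (r : ℝ) ≠ 0 := by positivity
  simp only [trigD_eq_integral_trigPsi h, trigPsi_zero, trigPsi_two_mul_sub_one hr, one_mul,
    intervalIntegral.integral_const_mul, integral_sin_nat_mul_zero_left hr,
    intervalIntegral.integral_div]
  rw [intervalIntegral.integral_sub (by simp) (Continuous.intervalIntegrable (by fun_prop) _ _),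
    integral_cos_nat_mul hr]
  simp
  field_simp
  norm_num

theorem trigD_even_zero : trigD t T (2 * r) 0 = 0 := by
  simp only [trigD_eq_integral_trigPsi h, trigPsi_zero, trigPsi_two_mul hr, one_mul,
    intervalIntegral.integral_const_mul, integral_cos_nat_mul_zero_left hr,
    intervalIntegral.integral_div, integral_sin_nat_mul]
  simp

include hs

theorem trigD_odd_odd : trigD t T (2 * r - 1) (2 * s - 1) = 0 := by
  have e (y : ℝ) : √2 * sin (s * y) * (√2 * ((1 - cos (r * y)) / r)) =
      2 / r * (sin (s * y) - sin (s * y) * cos (r * y)) := by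
    linear_combination sin (s * y) * ((1 - cos (r * y)) / r) * sq_sqrt (zero_le_two (α := ℝ))
  simp only [trigD_eq_integral_trigPsi h, trigPsi_two_mul_sub_one hr, trigPsi_two_mul_sub_one hs,
    intervalIntegral.integral_const_mul, integral_sin_nat_mul_zero_left hr, e]
  rw [intervalIntegral.integral_sub (Continuous.intervalIntegrable (by fun_prop) _ _)
    (Continuous.intervalIntegrable (by fun_prop) _ _), integral_sin_nat_mul,
    integral_sin_mul_cos_nat]
  simp

theorem trigD_odd_even :
    trigD t T (2 * r - 1) (2 * s) = if r = s then -((T - t) / (2 * π * r)) else 0 := by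
  have hr' : (r : ℝ) ≠ 0 := by positivity
  have e (y : ℝ) : √2 * cos (s * y) * (√2 * ((1 - cos (r * y)) / r)) =
      2 / r * (cos (s * y) - cos (r * y) * cos (s * y)) := by
    linear_combination cos (s * y) * ((1 - cos (r * y)) / r) * sq_sqrt (zero_le_two (α := ℝ))
  simp only [trigD_eq_integral_trigPsi h, trigPsi_two_mul_sub_one hr, trigPsi_two_mul hs,
    intervalIntegral.integral_const_mul, integral_sin_nat_mul_zero_left hr, e]
  rw [intervalIntegral.integral_sub (Continuous.intervalIntegrable (by fun_prop) _ _)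
    (Continuous.intervalIntegrable (by fun_prop) _ _), integral_cos_nat_mul hs,
    integral_cos_mul_cos_nat hr]
  split_ifs
  · field_simp
    norm_num
  · simp

theorem trigD_even_odd :
    trigD t T (2 * r) (2 * s - 1) = if r = s then (T - t) / (2 * π * r) else 0 := by
  have hr' : (r : ℝ) ≠ 0 := by positivity
  have e (y : ℝ) : √2 * sin (s * y) * (√2 * (sin (r * y) / r)) =
      2 / r * (sin (r * y) * sin (s * y)) := by
    linear_combination sin (s * y) * (sin (r * y) / r) * sq_sqrt (zero_le_two (α := ℝ))
  simp only [trigD_eq_integral_trigPsi h, trigPsi_two_mul_sub_one hs, trigPsi_two_mul hr,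
    intervalIntegral.integral_const_mul, integral_cos_nat_mul_zero_left hr, e,
    integral_sin_mul_sin_nat hr]
  split_ifs
  · field_simp
    norm_num
  · simp

theorem trigD_even_even : trigD t T (2 * r) (2 * s) = 0 := by
  have e (y : ℝ) : √2 * cos (s * y) * (√2 * (sin (r * y) / r)) =
      2 / r * (sin (r * y) * cos (s * y)) := by
    linear_combination cos (s * y) * (sin (r * y) / r) * sq_sqrt (zero_le_two (α := ℝ))
  simp only [trigD_eq_integral_trigPsi h, trigPsi_two_mul hs, trigPsi_two_mul hr,
    intervalIntegral.integral_const_mul, integral_cos_nat_mul_zero_left hr, e,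
    integral_sin_mul_cos_nat]
  simp

end Values

theorem eq_zero_or_eq_two_mul_sub_one_or_eq_two_mul (j : ℕ) :
    j = 0 ∨ ∃ r, 1 ≤ r ∧ (j = 2 * r - 1 ∨ j = 2 * r) := by
  by_cases hj : j = 0
  · exact .inl hj
  · exact .inr ⟨(j + 1) / 2, by omega, by omega⟩

/-- values of `D_{j₁ j₂}` for the trigonometric system:
`D₀₀ = (T−t)/2`; for `r ≥ 1`, `D_{2r,2r−1} = (T−t)/(2πr)`, `D_{2r−1,2r} = −(T−t)/(2πr)`,
`D_{2r−1,0} = √2(T−t)/(2πr)`, `D_{0,2r−1} = −√2(T−t)/(2πr)`; and `D_{j₁ j₂} = 0` for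
every pair `(j₁,j₂)` not of one of these five forms. -/
theorem trigD_values (t T : ℝ) (h : t < T) :
    trigD t T 0 0 = (T - t) / 2 ∧
    (∀ r : ℕ, 1 ≤ r →
      trigD t T (2 * r) (2 * r - 1) = (T - t) / (2 * Real.pi * r) ∧
      trigD t T (2 * r - 1) (2 * r) = -((T - t) / (2 * Real.pi * r)) ∧
      trigD t T (2 * r - 1) 0 = Real.sqrt 2 * (T - t) / (2 * Real.pi * r) ∧
      trigD t T 0 (2 * r - 1) = -(Real.sqrt 2 * (T - t) / (2 * Real.pi * r))) ∧
    (∀ j₁ j₂ : ℕ,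
      ¬(j₁ = 0 ∧ j₂ = 0) →
      (∀ r : ℕ, 1 ≤ r →
        ¬(j₁ = 2 * r ∧ j₂ = 2 * r - 1) ∧ ¬(j₁ = 2 * r - 1 ∧ j₂ = 2 * r) ∧
        ¬(j₁ = 2 * r - 1 ∧ j₂ = 0) ∧ ¬(j₁ = 0 ∧ j₂ = 2 * r - 1)) →
      trigD t T j₁ j₂ = 0) := by
  refine ⟨trigD_zero_zero h, fun r hr => ⟨?_, ?_, trigD_odd_zero h hr, trigD_zero_odd h hr⟩, ?_⟩
  · rw [trigD_even_odd h hr hr, if_pos rfl]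
  · rw [trigD_odd_even h hr hr, if_pos rfl]
  intro j₁ j₂ h0 hj
  obtain rfl | ⟨r, hr, rfl | rfl⟩ := eq_zero_or_eq_two_mul_sub_one_or_eq_two_mul j₁ <;>
    obtain rfl | ⟨s, hs, rfl | rfl⟩ := eq_zero_or_eq_two_mul_sub_one_or_eq_two_mul j₂
  · exact absurd ⟨rfl, rfl⟩ h0
  · exact absurd ⟨rfl, rfl⟩ (hj s hs).2.2.2
  · exact trigD_zero_even h hs
  · exact absurd ⟨rfl, rfl⟩ (hj r hr).2.2.1
  · exact trigD_odd_odd h hr hs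
  · rw [trigD_odd_even h hr hs, if_neg]
    rintro rfl
    exact (hj r hr).2.1 ⟨rfl, rfl⟩
  · exact trigD_even_zero h hr
  · rw [trigD_even_odd h hr hs, if_neg]
    rintro rfl
    exact (hj r hr).1 ⟨rfl, rfl⟩
  · exact trigD_even_even h hr hs
end
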